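/- arXiv:1303.5783 — 4 statements merged into one kernel-verified Lean document; each statement's English description precedes it below -/
import Mathlib

section
/- Let R be a PID with field of fractions K. Suppose X = A·R^n and Y = B·R^n with A, B ∈ GL_n(K), and suppose A·R_p^n = B·R_p^n inside K_p^n for every nonzero prime ideal p of R (where R_p is the valuation ring of the completion K_p). Then X = Y. -/
open IsDedekindDomain

section Defs

variable (R : Type*) [CommRing R] [IsDomain R] [IsPrincipalIdealRing R]
  (K : Type*) [Field K] [Algebra R K] [IsFractionRing R K] (n : ℕ)

/-- The standard lattice `R^n` viewed as an `R`-submodule of `K^n`. -/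
def stdLattice : Submodule R (Fin n → K) :=
  Submodule.pi Set.univ fun _ => LinearMap.range (Algebra.linearMap R K)

/-- The image `A · X` of an `R`-submodule `X` of `K^n` under an invertible matrix `A` over `K`. -/
def matMap (A : GL (Fin n) K) (X : Submodule R (Fin n → K)) : Submodule R (Fin n → K) :=
  X.map ((Matrix.toLin' (A : Matrix (Fin n) (Fin n) K)).restrictScalars R)

/-- The standard local lattice `R_p^n` inside `K_p^n`, as a set. -/
def intLat (v : HeightOneSpectrum R) : Set (Fin n → v.adicCompletion K) :=
  {x | ∀ i, x i ∈ v.adicCompletionIntegers K}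

/-- The image `A · S` of a subset `S ⊆ K_p^n` under an invertible matrix `A` over `K_p`. -/
def locMap (v : HeightOneSpectrum R) (A : GL (Fin n) (v.adicCompletion K))
    (S : Set (Fin n → v.adicCompletion K)) : Set (Fin n → v.adicCompletion K) :=
  (Matrix.toLin' (A : Matrix (Fin n) (Fin n) (v.adicCompletion K))) '' S

/-- The natural embedding `GL_n(K) → GL_n(K_p)`. -/
noncomputable def glEmb (v : HeightOneSpectrum R) : GL (Fin n) K →* GL (Fin n) (v.adicCompletion K) :=
  Matrix.GeneralLinearGroup.map (algebraMap K (v.adicCompletion K))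

/-- The natural embedding `K^n → K_p^n`. -/
noncomputable def vecEmb (v : HeightOneSpectrum R) (x : Fin n → K) : Fin n → v.adicCompletion K :=
  fun i => algebraMap K (v.adicCompletion K) (x i)

/-- A matrix over `K_p` lies in `GL_n(R_p)`: it and its inverse have `p`-integral entries. -/
def IsIntegralGL (v : HeightOneSpectrum R) (A : GL (Fin n) (v.adicCompletion K)) : Prop :=
  ∀ i j, (A : Matrix (Fin n) (Fin n) (v.adicCompletion K)) i j ∈ v.adicCompletionIntegers K ∧
    ((A⁻¹ : GL (Fin n) (v.adicCompletion K)) : Matrix (Fin n) (Fin n) (v.adicCompletion K)) i j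
      ∈ v.adicCompletionIntegers K

end Defs

section Lemmas

theorem mem_matMap_iff {R : Type*} [CommRing R] {K : Type*} [Field K] [Algebra R K] {n : ℕ}
    (A : GL (Fin n) K) (X : Submodule R (Fin n → K)) (x : Fin n → K) :
    x ∈ matMap R K n A X ↔
      Matrix.mulVec ((A⁻¹ : GL (Fin n) K) : Matrix (Fin n) (Fin n) K) x ∈ X := by
  simp only [matMap, Submodule.mem_map, LinearMap.restrictScalars_apply, Matrix.toLin'_apply]
  constructor
  · rintro ⟨y, hy, rfl⟩
    rwa [Matrix.mulVec_mulVec, Units.inv_mul, Matrix.one_mulVec]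
  · exact fun h => ⟨_, h, by rw [Matrix.mulVec_mulVec, Units.mul_inv, Matrix.one_mulVec]⟩

variable {R : Type*} [CommRing R] [IsDomain R] [IsPrincipalIdealRing R]
  {K : Type*} [Field K] [Algebra R K] [IsFractionRing R K] {n : ℕ}

theorem algebraMap_mem_adicCompletionIntegers_iff (v : HeightOneSpectrum R) (x : K) :
    algebraMap K (v.adicCompletion K) x ∈ v.adicCompletionIntegers K ↔ v.valuation K x ≤ 1 := by
  rw [HeightOneSpectrum.mem_adicCompletionIntegers]
  exact iff_of_eq (congrArg (· ≤ 1) (v.valuedAdicCompletion_eq_valuation' x))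

/-- Membership in the standard lattice can be tested locally. -/
theorem mem_stdLattice_iff_vecEmb (x : Fin n → K) :
    x ∈ stdLattice R K n ↔ ∀ v : HeightOneSpectrum R, vecEmb R K n v x ∈ intLat R K n v := by
  simp only [stdLattice, Submodule.mem_pi, Set.mem_univ, true_imp_iff, intLat, vecEmb,
    Set.mem_ofPred_eq, algebraMap_mem_adicCompletionIntegers_iff, LinearMap.mem_range,
    Algebra.linearMap_apply]
  refine ⟨fun h v i => ?_, fun h i =>
    HeightOneSpectrum.mem_integers_of_valuation_le_one K (x i) fun v => h v i⟩
  obtain ⟨r, hr⟩ := h i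
  exact hr ▸ v.valuation_le_one r

theorem vecEmb_mulVec (v : HeightOneSpectrum R) (A : GL (Fin n) K) (x : Fin n → K) :
    vecEmb R K n v (Matrix.mulVec (A : Matrix (Fin n) (Fin n) K) x) =
      Matrix.mulVec (glEmb R K n v A : Matrix (Fin n) (Fin n) (v.adicCompletion K))
        (vecEmb R K n v x) :=
  funext fun i => RingHom.map_mulVec (algebraMap K (v.adicCompletion K)) _ x i

theorem mem_locMap_iff (v : HeightOneSpectrum R) (A : GL (Fin n) (v.adicCompletion K))
    (S : Set (Fin n → v.adicCompletion K)) (x : Fin n → v.adicCompletion K) :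
    x ∈ locMap R K n v A S ↔
      Matrix.mulVec ((A⁻¹ : GL (Fin n) (v.adicCompletion K)) :
        Matrix (Fin n) (Fin n) (v.adicCompletion K)) x ∈ S := by
  simp only [locMap, Set.mem_image, Matrix.toLin'_apply]
  constructor
  · rintro ⟨y, hy, rfl⟩
    rwa [Matrix.mulVec_mulVec, Units.inv_mul, Matrix.one_mulVec]
  · exact fun h => ⟨_, h, by rw [Matrix.mulVec_mulVec, Units.mul_inv, Matrix.one_mulVec]⟩

/-- Membership in the lattice `A · R^n` can be tested locally. -/
theorem mem_matMap_stdLattice_iff_vecEmb (A : GL (Fin n) K) (x : Fin n → K) :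
    x ∈ matMap R K n A (stdLattice R K n) ↔ ∀ v : HeightOneSpectrum R,
      vecEmb R K n v x ∈ locMap R K n v (glEmb R K n v A) (intLat R K n v) := by
  simp only [mem_matMap_iff, mem_stdLattice_iff_vecEmb, vecEmb_mulVec, mem_locMap_iff, map_inv]

end Lemmas

theorem stmt9 (R : Type*) [CommRing R] [IsDomain R] [IsPrincipalIdealRing R]
    (K : Type*) [Field K] [Algebra R K] [IsFractionRing R K] (n : ℕ)
    (A B : GL (Fin n) K)
    (h : ∀ v : HeightOneSpectrum R,
      locMap R K n v (glEmb R K n v A) (intLat R K n v) =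
        locMap R K n v (glEmb R K n v B) (intLat R K n v)) :
    matMap R K n A (stdLattice R K n) = matMap R K n B (stdLattice R K n) := by
  ext x
  simp only [mem_matMap_stdLattice_iff_vecEmb, h]
end

section
/- Let R be a PID with field of fractions K. Suppose for each nonzero prime ideal p of R we are given an R_p-lattice X_p ⊆ K_p^n (a free R_p-submodule of rank n), with X_p = R_p^n for all but finitely many p. Then the set X' = { x ∈ K^n : x ∈ X_p for all p } is a free R-module of rank n. -/
open IsDedekindDomain

/-- A free submodule of full rank in `F^n` is commensurable with the standard lattice. -/
theorem exists_ne_zero_smul_lattice {A F : Type*} [CommRing A] [IsDomain A] [Field F] [Algebra A F]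
    [IsFractionRing A F] (n : ℕ) (X : Submodule A (Fin n → F)) [Module.Free A X]
    (hrank : Module.finrank A X = n) :
    ∃ a : A, a ≠ 0 ∧ (∀ i, a • (Pi.single i 1 : Fin n → F) ∈ X) ∧
      ∀ x ∈ X, ∀ i, ∃ c : A, algebraMap A F c = a • x i := by
  classical
  rcases Nat.eq_zero_or_pos n with rfl | hn
  · exact ⟨1, one_ne_zero, fun i => i.elim0, fun _ _ i => i.elim0⟩
  have : Module.Finite A X := Module.finite_of_finrank_pos (by omega)
  let b : Module.Basis (Fin n) A X := Module.finBasisOfFinrankEq A X hrank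
  have hbA : LinearIndependent A (fun i => (b i : Fin n → F)) :=
    b.linearIndependent.map' X.subtype (Submodule.ker_subtype X)
  have hbF : LinearIndependent F (fun i => (b i : Fin n → F)) :=
    (LinearIndependent.iff_fractionRing A F).1 hbA
  let B : Module.Basis (Fin n) F (Fin n → F) :=
    basisOfLinearIndependentOfCardEqFinrank' _ hbF (by simp)
  have hB : ∀ i, B i = b i := fun i => by simp [B]
  obtain ⟨s, hs⟩ := IsLocalization.exist_integer_multiples_of_finite (nonZeroDivisors A)
    (fun p : Fin n × Fin n => B.repr (Pi.single p.1 1) p.2)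
  obtain ⟨t, ht⟩ := IsLocalization.exist_integer_multiples_of_finite (nonZeroDivisors A)
    (fun p : Fin n × Fin n => (b p.1 : Fin n → F) p.2)
  choose cs hcs using hs
  choose ct hct using ht
  refine ⟨s * t, mul_ne_zero (nonZeroDivisors.coe_ne_zero s) (nonZeroDivisors.coe_ne_zero t),
    fun i => ?_, fun x hx i => ?_⟩
  · rw [mul_comm, mul_smul]
    refine X.smul_mem _ ?_
    have h : (s : A) • (Pi.single i 1 : Fin n → F) = ∑ j, cs (i, j) • (b j : Fin n → F) := by
      conv_lhs => rw [← B.sum_repr (Pi.single i 1), Finset.smul_sum]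
      refine Finset.sum_congr rfl fun j _ => ?_
      rw [← smul_assoc, ← algebraMap_smul F (cs (i, j)), hcs, hB]
    rw [h]
    exact X.sum_mem fun j _ => X.smul_mem _ (b j).2
  · refine ⟨s * ∑ j, b.repr ⟨x, hx⟩ j * ct (j, i), ?_⟩
    have h : x i = ∑ j, b.repr ⟨x, hx⟩ j • (b j : Fin n → F) i := by
      have h' := congrArg (fun y : X => (y : Fin n → F) i) (b.sum_repr ⟨x, hx⟩)
      simpa [-Module.Basis.sum_repr] using h'.symm
    rw [h, mul_smul, Algebra.smul_def, map_mul, Finset.smul_sum, map_sum]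
    congr 1
    refine Finset.sum_congr rfl fun j _ => ?_
    rw [map_mul, hct, smul_comm, Algebra.smul_def (b.repr ⟨x, hx⟩ j)]

/-- The scalar comparing a local lattice with the standard one can be chosen in the base ring. -/
theorem exists_ne_zero_smul_adic_lattice {R : Type*} [CommRing R] [IsDedekindDomain R]
    {K : Type*} [Field K] [Algebra R K] [IsFractionRing R K] (n : ℕ) (v : HeightOneSpectrum R)
    (X : Submodule (v.adicCompletionIntegers K) (Fin n → v.adicCompletion K))
    [Module.Free (v.adicCompletionIntegers K) X]
    (hrank : Module.finrank (v.adicCompletionIntegers K) X = n) :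
    ∃ r : R, r ≠ 0 ∧
      (∀ i, algebraMap R (v.adicCompletionIntegers K) r •
        (Pi.single i 1 : Fin n → v.adicCompletion K) ∈ X) ∧
      ∀ x ∈ X, ∀ i, algebraMap R (v.adicCompletionIntegers K) r • x i ∈
        v.adicCompletionIntegers K := by
  obtain ⟨a, ha, h1, h2⟩ := exists_ne_zero_smul_lattice n X hrank
  obtain ⟨r, hr₀, hr⟩ := HeightOneSpectrum.adicCompletion.mul_nonZeroDivisor_mem_adicCompletionIntegers
    v (a : v.adicCompletion K)⁻¹
  have ha' : (a : v.adicCompletion K) ≠ 0 := by simpa using ha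
  have key : algebraMap R (v.adicCompletionIntegers K) r = ⟨_, hr⟩ * a := by
    apply Subtype.ext
    simp only [MulMemClass.coe_mul, HeightOneSpectrum.algebraMap_adicCompletionIntegers_apply]
    rw [mul_comm, ← mul_assoc, mul_inv_cancel₀ ha', one_mul]
    rfl
  refine ⟨r, nonZeroDivisors.ne_zero hr₀, fun i => ?_, fun x hx i => ?_⟩
  · rw [key, mul_smul]
    exact X.smul_mem _ (h1 i)
  · obtain ⟨c, hc⟩ := h2 x hx i
    rw [key, mul_smul, ← hc]
    exact mul_mem hr c.2

/-- An element of `K` that is integral at every prime lies in `R`. -/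
theorem exists_algebraMap_eq_of_forall_mem_adicCompletionIntegers {R : Type*} [CommRing R]
    [IsDedekindDomain R] {K : Type*} [Field K] [Algebra R K] [IsFractionRing R K] (x : K)
    (h : ∀ v : HeightOneSpectrum R,
      algebraMap K (v.adicCompletion K) x ∈ v.adicCompletionIntegers K) :
    ∃ r : R, algebraMap R K r = x := by
  refine HeightOneSpectrum.mem_integers_of_valuation_le_one K x fun v => ?_
  rw [← HeightOneSpectrum.valuedAdicCompletion_eq_valuation']
  exact (HeightOneSpectrum.mem_adicCompletionIntegers R K v).1 (h v)

/-- A submodule of `K^n` lying between two multiples of `R^n` is free of rank `n`. -/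
theorem free_and_finrank_eq_of_smul_lattice {R : Type*} [CommRing R] [IsDomain R]
    [IsPrincipalIdealRing R] {K : Type*} [Field K] [Algebra R K] [IsFractionRing R K] (n : ℕ)
    (X : Submodule R (Fin n → K)) (d : R) (hd : d ≠ 0)
    (hsingle : ∀ i, d • (Pi.single i 1 : Fin n → K) ∈ X)
    (hint : ∀ x ∈ X, ∀ i, ∃ c : R, algebraMap R K c = d • x i) :
    Module.Free R X ∧ Module.finrank R X = n := by
  classical
  have hinj : Function.Injective (algebraMap R K) := IsFractionRing.injective R K
  choose c hc using hint
  let f : X →ₗ[R] (Fin n → R) :=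
    { toFun := fun x => c x x.2
      map_add' := fun x y => by
        ext i
        apply hinj
        simp [hc]
      map_smul' := fun r x => by
        ext i
        apply hinj
        simp [hc, Algebra.smul_def, mul_left_comm] }
  have hf : Function.Injective f := fun x y hxy => by
    ext i
    have h := congrArg (algebraMap R K) (congrFun hxy i)
    have h' : d • (x : Fin n → K) i = d • (y : Fin n → K) i := by
      rw [← hc _ x.2, ← hc _ y.2]
      exact h
    exact smul_right_injective K hd h'
  let e : Fin n → X := fun i => ⟨d • Pi.single i 1, hsingle i⟩
  have he : LinearIndependent R e := by
    rw [Fintype.linearIndependent_iff]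
    intro g hg i
    have h := congrArg (fun y : X => (y : Fin n → K) i) hg
    have h' : g i • d • (1 : K) = 0 := by
      simpa [e, Pi.single_apply] using h
    simpa [smul_eq_zero, hd] using h'
  have : Module.Finite R X := Module.Finite.of_injective f hf
  have : Module.Free R X := Module.free_of_finite_type_torsion_free'
  refine ⟨this, le_antisymm ?_ ?_⟩
  · simpa using LinearMap.finrank_le_finrank_of_injective hf
  · simpa using he.fintype_card_le_finrank

theorem stmt10 (R : Type*) [CommRing R] [IsDomain R] [IsPrincipalIdealRing R]
    (K : Type*) [Field K] [Algebra R K] [IsFractionRing R K] (n : ℕ)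
    (X : ∀ v : HeightOneSpectrum R,
      Submodule (v.adicCompletionIntegers K) (Fin n → v.adicCompletion K))
    (hfree : ∀ v, Module.Free (v.adicCompletionIntegers K) (X v))
    (hrank : ∀ v, Module.finrank (v.adicCompletionIntegers K) (X v) = n)
    (halmost : {v : HeightOneSpectrum R | (X v : Set _) ≠ intLat R K n v}.Finite)
    (X' : Submodule R (Fin n → K))
    (hX' : (X' : Set (Fin n → K)) = {x | ∀ v, vecEmb R K n v x ∈ X v}) :
    Module.Free R X' ∧ Module.finrank R X' = n := by
  classical
  have hloc : ∀ v, ∃ r : R, r ≠ 0 ∧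
      ((X v : Set _) = intLat R K n v → r = 1) ∧
      (∀ i, algebraMap R (v.adicCompletionIntegers K) r •
        (Pi.single i 1 : Fin n → v.adicCompletion K) ∈ X v) ∧
      ∀ x ∈ X v, ∀ i, algebraMap R (v.adicCompletionIntegers K) r • x i ∈
        v.adicCompletionIntegers K := by
    intro v
    by_cases h : (X v : Set _) = intLat R K n v
    · have hm : ∀ x, x ∈ X v ↔ ∀ i, x i ∈ v.adicCompletionIntegers K := fun x => by
        rw [← SetLike.mem_coe, h]
        rfl
      refine ⟨1, one_ne_zero, fun _ => rfl, fun i => ?_, fun x hx i => ?_⟩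
      · rw [map_one, one_smul, hm]
        intro j
        rw [Pi.single_apply]
        split_ifs
        exacts [one_mem _, zero_mem _]
      · rw [map_one, one_smul]
        exact (hm x).1 hx i
    · have := hfree v
      obtain ⟨r, hr, h1, h2⟩ := exists_ne_zero_smul_adic_lattice n v (X v) (hrank v)
      exact ⟨r, hr, fun h' => (h h').elim, h1, h2⟩
  choose r hr hr1 hsingle hint using hloc
  let d : R := ∏ v ∈ halmost.toFinset, r v
  have hdvd : ∀ v, r v ∣ d := fun v => by
    by_cases h : (X v : Set _) = intLat R K n v
    · rw [hr1 v h]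
      exact one_dvd _
    · exact Finset.dvd_prod_of_mem r (halmost.mem_toFinset.2 h)
  have hmem : ∀ x, x ∈ X' ↔ ∀ v, vecEmb R K n v x ∈ X v := fun x => by
    rw [← SetLike.mem_coe, hX']
    rfl
  have hmap : ∀ (v : HeightOneSpectrum R) (y : K), algebraMap K (v.adicCompletion K) (d • y) =
      algebraMap R (v.adicCompletionIntegers K) d • algebraMap K (v.adicCompletion K) y := by
    intro v y
    rw [Algebra.smul_def, map_mul]
    rfl
  refine free_and_finrank_eq_of_smul_lattice n X' d
    (Finset.prod_ne_zero_iff.2 fun v _ => hr v) (fun i => ?_) fun x hx i => ?_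
  · rw [hmem]
    intro v
    obtain ⟨c, hc⟩ := hdvd v
    have h : vecEmb R K n v (d • Pi.single i 1) =
        algebraMap R (v.adicCompletionIntegers K) d • Pi.single i 1 := by
      ext1 j
      simp only [vecEmb, Pi.smul_apply, hmap]
      congr 1
      rw [Pi.single_apply, Pi.single_apply]
      split_ifs
      exacts [map_one _, map_zero _]
    rw [h, hc, mul_comm, map_mul, mul_smul]
    exact (X v).smul_mem _ (hsingle v i)
  · refine exists_algebraMap_eq_of_forall_mem_adicCompletionIntegers _ fun v => ?_
    obtain ⟨c, hc⟩ := hdvd v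
    rw [hmap, hc, mul_comm, map_mul, mul_smul]
    exact mul_mem (algebraMap R (v.adicCompletionIntegers K) c).2
      (hint v _ ((hmem x).1 hx v) i)
end

section
/- Let R be a PID with field of fractions K. Suppose for each nonzero prime ideal p of R we are given an R_p-lattice X_p ⊆ K_p^n, with X_p = R_p^n for all but finitely many p, and let X' = { x ∈ K^n : x ∈ X_p for all p }. Then for every nonzero prime p of R, the localized lattice X'_p (the R_p-span of X' in K_p^n) equals X_p. -/
open IsDedekindDomain

namespace IsDedekindDomain.HeightOneSpectrum

variable {R : Type*} [CommRing R] [IsDedekindDomain R]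

/-- Outside a given prime `v`, finitely many divisibility conditions can be met by an element
prime to `v`. -/
theorem exists_notMem_and_forall_mem_pow (v : HeightOneSpectrum R)
    (S : Finset (HeightOneSpectrum R)) (hv : v ∉ S) (e : HeightOneSpectrum R → ℕ) :
    ∃ t : R, t ∉ v.asIdeal ∧ ∀ w ∈ S, t ∈ w.asIdeal ^ e w := by
  have hnot : ¬ (∏ w ∈ S, w.asIdeal ^ e w) ≤ v.asIdeal := by
    intro hle
    obtain ⟨w, hwS, hw⟩ := (Ideal.IsPrime.prod_le v.isPrime).1 hle
    have hwv : w.asIdeal ≤ v.asIdeal := v.isPrime.le_of_pow_le hw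
    have : w = v := HeightOneSpectrum.ext (w.isMaximal.eq_of_le v.isPrime.ne_top hwv)
    exact hv (this ▸ hwS)
  obtain ⟨t, ht, htv⟩ := SetLike.not_le_iff_exists.1 hnot
  exact ⟨t, htv, fun w hw ↦ Ideal.le_of_dvd (Finset.dvd_prod_of_mem _ hw) ht⟩

/-- In a principal ideal domain, a generator of `v` is a uniformizer at `v` and a unit at every
other prime. -/
theorem exists_intValuation_eq_exp_neg_one_and_eq_one {R : Type*} [CommRing R] [IsDomain R]
    [IsPrincipalIdealRing R] (v : HeightOneSpectrum R) :
    ∃ p : R, v.intValuation p = WithZero.exp (-1 : ℤ) ∧ ∀ w ≠ v, w.intValuation p = 1 := by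
  obtain ⟨p, hp⟩ := (IsPrincipalIdealRing.principal v.asIdeal).principal
  have hp : v.asIdeal = Ideal.span {p} := hp
  have hp0 : p ≠ 0 := fun h ↦ v.ne_bot (by simp [hp, h])
  refine ⟨p, intValuation_singleton v hp0 hp, fun w hw ↦ ?_⟩
  rw [intValuation_eq_one_iff]
  intro hpw
  refine hw (HeightOneSpectrum.ext (v.isMaximal.eq_of_le w.isPrime.ne_top ?_).symm)
  rw [hp]
  exact (Ideal.span_singleton_le_iff_mem _).2 hpw

variable {K : Type*} [Field K] [Algebra R K] [IsFractionRing R K]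

theorem valued_algebraMap (v : HeightOneSpectrum R) (k : K) :
    Valued.v (algebraMap K (v.adicCompletion K) k) = v.valuation K k :=
  valuedAdicCompletion_eq_valuation' v k

theorem exists_valued_algebraMap_sub_lt (v : HeightOneSpectrum R) (y : v.adicCompletion K)
    (γ : (WithZero (Multiplicative ℤ))ˣ) :
    ∃ k : K, Valued.v (algebraMap K (v.adicCompletion K) k - y) <
      (γ : WithZero (Multiplicative ℤ)) := by
  obtain ⟨g, hg⟩ := v.valuation_surjective K (γ : WithZero (Multiplicative ℤ))
  have hg0 : Valued.v.restrict (algebraMap K (v.adicCompletion K) g) ≠ 0 := by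
    rw [Valuation.ne_zero_iff, ← Valuation.ne_zero_iff Valued.v, valued_algebraMap, hg]
    exact γ.ne_zero
  have hopen : {x : v.adicCompletion K | Valued.v (x - y) < (γ : WithZero (Multiplicative ℤ))} ∈
      nhds y := by
    rw [Valued.mem_nhds]
    refine ⟨Units.mk0 _ hg0, fun x hx ↦ ?_⟩
    rw [Set.mem_ofPred_eq, Units.val_mk0, Valuation.restrict_lt_iff, valued_algebraMap, hg] at hx
    exact hx
  obtain ⟨k, hk⟩ := (denseRange_algebraMap K v).exists_mem_open isOpen_interior
    ⟨y, mem_interior_iff_mem_nhds.2 hopen⟩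
  have hk' := interior_subset hk
  exact ⟨k, hk'⟩

theorem exists_valued_algebraMap_sub_lt_of_integer (v : HeightOneSpectrum R)
    {y : v.adicCompletion K} (hy : Valued.v y ≤ 1) (γ : (WithZero (Multiplicative ℤ))ˣ) :
    ∃ r : R, Valued.v (algebraMap K (v.adicCompletion K) (algebraMap R K r) - y) <
      (γ : WithZero (Multiplicative ℤ)) := by
  obtain ⟨k, hk⟩ := exists_valued_algebraMap_sub_lt v y (min γ 1)
  rw [Units.min_val, lt_min_iff, Units.val_one] at hk
  have hk1 : v.valuation K k ≤ 1 := by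
    rw [← valued_algebraMap, ← sub_add_cancel (algebraMap K (v.adicCompletion K) k) y]
    exact Valuation.map_add_le _ hk.2.le hy
  obtain ⟨r, hr⟩ := exists_valuation_sub_lt_of_integer v hk1 γ
  refine ⟨r, ?_⟩
  rw [← sub_add_sub_cancel _ (algebraMap K (v.adicCompletion K) k) y, ← map_sub]
  refine Valuation.map_add_lt _ ?_ hk.1
  rwa [valued_algebraMap]

/-- Strong approximation at a single prime of a principal ideal domain. -/
theorem exists_valued_sub_lt_and_forall_valuation_le {R : Type*} [CommRing R] [IsDomain R]
    [IsPrincipalIdealRing R] {K : Type*} [Field K] [Algebra R K] [IsFractionRing R K]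
    (v : HeightOneSpectrum R) (y : v.adicCompletion K) (γ : (WithZero (Multiplicative ℤ))ˣ)
    (S : Finset (HeightOneSpectrum R)) (hv : v ∉ S)
    (δ : HeightOneSpectrum R → (WithZero (Multiplicative ℤ))ˣ) :
    ∃ z : K,
      Valued.v (algebraMap K (v.adicCompletion K) z - y) < (γ : WithZero (Multiplicative ℤ)) ∧
      (∀ w ∈ S, w.valuation K z ≤ (δ w : WithZero (Multiplicative ℤ))) ∧
      ∀ w ≠ v, w.valuation K z ≤ 1 := by
  have hδ (w : HeightOneSpectrum R) :
      ∃ e : ℕ, WithZero.exp (-(e : ℤ)) < (δ w : WithZero (Multiplicative ℤ)) :=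
    WithZero.exists_exp_neg_natCast_lt (δ w).ne_zero
  choose e he using hδ
  obtain ⟨t, htv, htS⟩ := exists_notMem_and_forall_mem_pow v S hv e
  obtain ⟨p, hpv, hpw⟩ := exists_intValuation_eq_exp_neg_one_and_eq_one v
  obtain ⟨m, hm⟩ : ∃ m : ℕ, Valued.v y * WithZero.exp (-(m : ℤ)) ≤ 1 := by
    by_cases hy0 : Valued.v y = 0
    · exact ⟨0, by simp [hy0]⟩
    · obtain ⟨m, hm⟩ := WithZero.exists_exp_neg_natCast_lt (inv_ne_zero hy0)
      refine ⟨m, ?_⟩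
      grw [hm.le]
      exact (mul_inv_cancel₀ hy0).le
  have hp0 : algebraMap R K p ≠ 0 := by
    intro h
    have : v.valuation K (algebraMap R K p) = 0 := by rw [h, map_zero]
    rw [valuation_of_algebraMap, hpv] at this
    exact WithZero.exp_ne_zero this
  set c : K := algebraMap R K t / algebraMap R K p ^ m with hc
  have hcv : v.valuation K c = WithZero.exp (m : ℤ) := by
    rw [hc, map_div₀, map_pow, valuation_of_algebraMap, valuation_of_algebraMap, hpv,
      intValuation_eq_one_iff.2 htv]
    simp [← WithZero.exp_nsmul, ← WithZero.exp_neg]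
  have hc0 : c ≠ 0 := by
    intro h
    rw [h, map_zero] at hcv
    exact WithZero.exp_ne_zero hcv.symm
  have hcw (w : HeightOneSpectrum R) (hw : w ≠ v) : w.valuation K c = w.intValuation t := by
    rw [hc, map_div₀, map_pow, valuation_of_algebraMap, valuation_of_algebraMap, hpw w hw]
    simp
  set c' := algebraMap K (v.adicCompletion K) c with hc'
  have hc'0 : c' ≠ 0 := by simpa [hc'] using hc0
  have hc'v : Valued.v c' = WithZero.exp (m : ℤ) := by rw [hc', valued_algebraMap, hcv]
  have hy : Valued.v (y / c') ≤ 1 := by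
    rwa [map_div₀, hc'v, div_eq_mul_inv, ← WithZero.exp_neg]
  obtain ⟨s, hs⟩ := exists_valued_algebraMap_sub_lt_of_integer v hy
    (γ * (Units.mk0 (WithZero.exp (m : ℤ)) WithZero.exp_ne_zero)⁻¹)
  have hle (w : HeightOneSpectrum R) (hw : w ≠ v) :
      w.valuation K (c * algebraMap R K s) ≤ w.intValuation t := by
    rw [map_mul, hcw w hw]
    exact mul_le_of_le_one_right' (valuation_le_one w s)
  refine ⟨c * algebraMap R K s, ?_, fun w hw ↦ ?_, fun w hw ↦
    (hle w hw).trans (intValuation_le_one w t)⟩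
  · have : algebraMap K (v.adicCompletion K) (c * algebraMap R K s) - y =
        c' * (algebraMap K (v.adicCompletion K) (algebraMap R K s) - y / c') := by
      rw [map_mul, mul_sub, mul_div_cancel₀ _ hc'0]
    rw [this, map_mul, hc'v, mul_comm]
    rw [Units.val_mul, Units.val_inv_eq_inv_val, Units.val_mk0, ← div_eq_mul_inv] at hs
    exact (lt_div_iff₀ (by simp)).1 hs
  · exact (hle w (fun h ↦ hv (h ▸ hw))).trans
      (((intValuation_le_pow_iff_mem w t _).2 (htS w hw)).trans (he w).le)

end IsDedekindDomain.HeightOneSpectrum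

/-- A free submodule of full rank of `F^n`, for `F` the field of fractions of `A`, contains a
nonzero multiple of the standard lattice. -/
theorem Submodule.exists_forall_smul_mem_of_finrank_eq {A F : Type*} [CommRing A] [IsDomain A]
    [Field F] [Algebra A F] [IsFractionRing A F] {n : ℕ} (X : Submodule A (Fin n → F))
    [Module.Free A X] [Module.Finite A X] (hX : Module.finrank A X = n) :
    ∃ d : A, d ≠ 0 ∧ ∀ x : Fin n → A, (d • fun i ↦ algebraMap A F (x i)) ∈ X := by
  let b := Module.finBasisOfFinrankEq A X hX
  have hb : LinearIndependent A (fun i ↦ (b i : Fin n → F)) :=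
    b.linearIndependent.map' X.subtype X.ker_subtype
  have hbF : LinearIndependent F (fun i ↦ (b i : Fin n → F)) :=
    (LinearIndependent.iff_fractionRing A F).1 hb
  let B := basisOfLinearIndependentOfCardEqFinrank' (b := fun i ↦ (b i : Fin n → F)) hbF (by simp)
  have hB (j : Fin n) : B j = b j := by simp [B]
  obtain ⟨d, hd⟩ := IsLocalization.exist_integer_multiples_of_finite (nonZeroDivisors A)
    (fun ij : Fin n × Fin n ↦ B.repr (Pi.single ij.1 1) ij.2)
  have hsingle (i : Fin n) : ((d : A) • Pi.single i (1 : F) : Fin n → F) ∈ X := by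
    rw [← B.sum_repr (Pi.single i 1), Finset.smul_sum]
    refine X.sum_mem fun j _ ↦ ?_
    obtain ⟨a, ha⟩ := hd (i, j)
    rw [← smul_assoc, ← ha, hB, algebraMap_smul]
    exact X.smul_mem a (b j).2
  refine ⟨d, nonZeroDivisors.coe_ne_zero d, fun x ↦ ?_⟩
  have : ((d : A) • fun i ↦ algebraMap A F (x i)) =
      ∑ i, x i • ((d : A) • Pi.single i (1 : F) : Fin n → F) := by
    ext k
    simp [Finset.sum_apply, Pi.single_apply, Algebra.smul_def, mul_comm]
  rw [this]
  exact X.sum_mem fun i _ ↦ X.smul_mem _ (hsingle i)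

open HeightOneSpectrum in
/-- A full lattice in `K_v^n` is a neighbourhood of zero. -/
theorem Submodule.exists_forall_valued_le_imp_mem {R : Type*} [CommRing R] [IsDedekindDomain R]
    {K : Type*} [Field K] [Algebra R K] [IsFractionRing R K] {n : ℕ} (v : HeightOneSpectrum R)
    (X : Submodule (v.adicCompletionIntegers K) (Fin n → v.adicCompletion K))
    [Module.Free (v.adicCompletionIntegers K) X] [Module.Finite (v.adicCompletionIntegers K) X]
    (hX : Module.finrank (v.adicCompletionIntegers K) X = n) :
    ∃ γ : (WithZero (Multiplicative ℤ))ˣ, ∀ x : Fin n → v.adicCompletion K,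
      (∀ i, Valued.v (x i) ≤ (γ : WithZero (Multiplicative ℤ))) → x ∈ X := by
  obtain ⟨d, hd0, hd⟩ := X.exists_forall_smul_mem_of_finrank_eq hX
  have hd0' : (d : v.adicCompletion K) ≠ 0 := by simpa using hd0
  have hv0 : Valued.v (d : v.adicCompletion K) ≠ 0 := (Valuation.ne_zero_iff _).2 hd0'
  refine ⟨Units.mk0 _ hv0, fun x hx ↦ ?_⟩
  have hmem (i : Fin n) : x i / d ∈ v.adicCompletionIntegers K := by
    rw [mem_adicCompletionIntegers, map_div₀]
    exact div_le_one_of_le₀ (hx i) zero_le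
  convert hd fun i ↦ ⟨x i / d, hmem i⟩ using 1
  funext i
  exact (mul_div_cancel₀ (x i) hd0').symm

open HeightOneSpectrum in
theorem stmt11 (R : Type*) [CommRing R] [IsDomain R] [IsPrincipalIdealRing R]
    (K : Type*) [Field K] [Algebra R K] [IsFractionRing R K] (n : ℕ)
    (X : ∀ v : HeightOneSpectrum R,
      Submodule (v.adicCompletionIntegers K) (Fin n → v.adicCompletion K))
    (hfree : ∀ v, Module.Free (v.adicCompletionIntegers K) (X v))
    (hrank : ∀ v, Module.finrank (v.adicCompletionIntegers K) (X v) = n)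
    (halmost : {v : HeightOneSpectrum R | (X v : Set _) ≠ intLat R K n v}.Finite) :
    ∀ v : HeightOneSpectrum R,
      Submodule.span (v.adicCompletionIntegers K)
        (vecEmb R K n v '' {x : Fin n → K | ∀ w, vecEmb R K n w x ∈ X w}) = X v := by
  classical
  intro v
  have hfin (w : HeightOneSpectrum R) : Module.Finite (w.adicCompletionIntegers K) (X w) := by
    rcases Nat.eq_zero_or_pos n with rfl | hn
    · infer_instance
    · exact Module.finite_of_finrank_pos (by rwa [hrank w])
  choose δ hδ using fun w ↦ (X w).exists_forall_valued_le_imp_mem w (hrank w)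
  obtain ⟨p, hpv, -⟩ := exists_intValuation_eq_exp_neg_one_and_eq_one v
  set q : v.adicCompletionIntegers K := algebraMap R _ p with hq
  have hqv : Valued.v (q : v.adicCompletion K) = WithZero.exp (-1 : ℤ) := by
    rw [← hpv, ← valuation_of_algebraMap (K := K)]
    exact valuedAdicCompletion_eq_valuation v p
  have hq0 : (q : v.adicCompletion K) ≠ 0 := by
    rw [← Valuation.ne_zero_iff Valued.v, hqv]
    exact WithZero.exp_ne_zero
  have hqmem : q ∈ IsLocalRing.maximalIdeal (v.adicCompletionIntegers K) := by
    rw [IsLocalRing.mem_maximalIdeal, mem_nonunits_iff,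
      adicCompletionIntegers.isUnit_iff_valued_eq_one, hqv, ← WithZero.exp_zero,
      WithZero.exp_inj]
    decide
  refine le_antisymm (Submodule.span_le.2 ?_) ?_
  · rintro _ ⟨x, hx, rfl⟩
    exact hx v
  · refine Submodule.le_of_le_smul_of_le_jacobson_bot
      (I := IsLocalRing.maximalIdeal (v.adicCompletionIntegers K))
      (Module.Finite.iff_fg.1 (hfin v)) (IsLocalRing.jacobson_eq_maximalIdeal ⊥ bot_ne_top).ge ?_
    intro x hx
    choose z hzv hzS hz using fun i ↦ exists_valued_sub_lt_and_forall_valuation_le v (x i)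
      (Units.mk0 _ ((Valuation.ne_zero_iff Valued.v).2 hq0) * δ v) (halmost.toFinset.erase v)
      (Finset.notMem_erase v _) δ
    have hu : (fun i ↦ (vecEmb R K n v z i - x i) / q) ∈ X v := by
      refine hδ v _ fun i ↦ ?_
      rw [map_div₀]
      refine div_le_of_le_mul₀ zero_le zero_le ?_
      rw [mul_comm]
      exact (hzv i).le
    have hsub : vecEmb R K n v z - x =
        q • fun i ↦ (vecEmb R K n v z i - x i) / (q : v.adicCompletion K) := by
      funext i
      exact (mul_div_cancel₀ _ hq0).symm
    have hsubX : vecEmb R K n v z - x ∈ X v := hsub ▸ (X v).smul_mem q hu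
    have hzmem : ∀ w, vecEmb R K n w z ∈ X w := by
      intro w
      by_cases hwv : w = v
      · subst hwv
        simpa using add_mem hsubX hx
      by_cases hw : (X w : Set _) = intLat R K n w
      · rw [← SetLike.mem_coe, hw]
        intro i
        rw [mem_adicCompletionIntegers]
        exact (valued_algebraMap w (z i)).trans_le (hz i w hwv)
      · refine hδ w _ fun i ↦ (valued_algebraMap w (z i)).trans_le (hzS i w ?_)
        simp [hwv, hw]
    rw [← sub_sub_cancel (vecEmb R K n v z) x]
    refine sub_mem (Submodule.mem_sup_left (Submodule.subset_span ⟨z, hzmem, rfl⟩))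
      (Submodule.mem_sup_right ?_)
    rw [hsub]
    exact Submodule.smul_mem_smul hqmem hu
end

section
/- Let R be a PID with field of fractions K, and let GL_n(A_R) denote the restricted direct product of the groups GL_n(K_p) with respect to the subgroups GL_n(R_p), over all nonzero primes p of R. Then GL_n(A_R) = GL_n^0(A_R) · GL_n(K), where GL_n^0(A_R) = ∏_p GL_n(R_p) and GL_n(K) is embedded diagonally as principal adeles. That is, every adelic matrix (A_p) can be written as (C_p)·B with C_p ∈ GL_n(R_p) for all p and B ∈ GL_n(K). -/
open IsDedekindDomain

open Matrix in
/-- The transvection `1 + c • E i j`, as an element of the general linear group. -/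
def transvectionGL {ι F : Type*} [Fintype ι] [DecidableEq ι] [CommRing F] {i j : ι} (hij : i ≠ j)
    (c : F) : GL ι F where
  val := transvection i j c
  inv := transvection i j (-c)
  val_inv := by rw [transvection_mul_transvection_same _ _ hij, add_neg_cancel, transvection_zero]
  inv_val := by rw [transvection_mul_transvection_same _ _ hij, neg_add_cancel, transvection_zero]

open Matrix in
/-- The invertible diagonal matrix with the given units on the diagonal. -/
def diagonalGL {ι F : Type*} [Fintype ι] [DecidableEq ι] [CommRing F] (d : ι → Fˣ) : GL ι F where
  val := diagonal fun i => (d i : F)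
  inv := diagonal fun i => ((d i)⁻¹ : Fˣ)
  val_inv := by simp
  inv_val := by simp

section LinearGroup

variable {ι F : Type*} [Fintype ι] [DecidableEq ι]

theorem diagonalGL_mul [CommRing F] (d e : ι → Fˣ) :
    diagonalGL (d * e) = diagonalGL d * diagonalGL e := by
  ext1
  simp [diagonalGL]

theorem transvectionGL_mul_diagonalGL [CommRing F] {i j : ι} (hij : i ≠ j) (c : F) (d : ι → Fˣ) :
    transvectionGL hij c * diagonalGL d =
      diagonalGL d * transvectionGL hij (((d i)⁻¹ : Fˣ) * c * d j) := by
  ext a b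
  simp only [transvectionGL, diagonalGL, Units.val_mul, Matrix.mul_diagonal, Matrix.diagonal_mul,
    Matrix.transvection, Matrix.add_apply, Matrix.one_apply, Matrix.single_apply]
  split_ifs with hab h <;> simp_all [← mul_assoc]

theorem map_transvectionGL [CommRing F] {E : Type*} [CommRing E] (f : F →+* E) {i j : ι}
    (hij : i ≠ j) (c : F) :
    Matrix.GeneralLinearGroup.map f (transvectionGL hij c) = transvectionGL hij (f c) := by
  ext a b
  simp [transvectionGL, Matrix.transvection, Matrix.one_apply, Matrix.single_apply, apply_ite f]

theorem map_diagonalGL [CommRing F] {E : Type*} [CommRing E] (f : F →+* E) (d : ι → Fˣ) :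
    Matrix.GeneralLinearGroup.map f (diagonalGL d) =
      diagonalGL fun i => Units.map (f : F →* E) (d i) := by
  ext a b
  simp [diagonalGL, Matrix.diagonal_apply, apply_ite f]

theorem continuous_transvectionGL [CommRing F] [TopologicalSpace F] [IsTopologicalRing F]
    {i j : ι} (hij : i ≠ j) : Continuous (transvectionGL hij : F → GL ι F) := by
  have h : Continuous (Matrix.transvection i j : F → Matrix ι ι F) := by
    refine continuous_const.add (continuous_matrix fun a b => ?_)
    simp only [Matrix.single_apply]
    split_ifs <;> fun_prop
  exact Units.continuous_iff.2 ⟨h, h.comp continuous_neg⟩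

/-- If a subgroup `H` of the general linear group contains all transvections and represents all
diagonal matrices modulo diagonal matrices with entries in `T`, then the whole group is the
product of the group of diagonal matrices with entries in `T` and of `H`. -/
theorem exists_eq_diagonalGL_mul [Field F] (T : Subgroup Fˣ) (H : Subgroup (GL ι F))
    (htrans : ∀ (i j : ι) (hij : i ≠ j) (c : F), transvectionGL hij c ∈ H)
    (hdiag : ∀ d : ι → Fˣ, ∃ u : ι → Fˣ, (∀ i, u i ∈ T) ∧ ∃ e, d = u * e ∧ diagonalGL e ∈ H)
    (A : GL ι F) : ∃ u : ι → Fˣ, (∀ i, u i ∈ T) ∧ ∃ h ∈ H, A = diagonalGL u * h := by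
  suffices key : ∀ u : ι → Fˣ, (∀ i, u i ∈ T) → ∃ u' : ι → Fˣ, (∀ i, u' i ∈ T) ∧ ∃ h ∈ H,
      (A : Matrix ι ι F) * (diagonalGL u : GL ι F) = (diagonalGL u' : GL ι F) * (h : GL ι F) by
    obtain ⟨u, hu, h, hh, e⟩ := key 1 fun _ => T.one_mem
    exact ⟨u, hu, h, hh, Units.ext (by simpa [diagonalGL] using e)⟩
  refine Matrix.diagonal_transvection_induction_of_det_ne_zero (fun M : Matrix ι ι F =>
    ∀ u : ι → Fˣ, (∀ i, u i ∈ T) → ∃ u' : ι → Fˣ, (∀ i, u' i ∈ T) ∧ ∃ h ∈ H,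
      M * (diagonalGL u : GL ι F) = (diagonalGL u' : GL ι F) * (h : GL ι F)) A
    ((Matrix.isUnit_iff_isUnit_det _).1 A.isUnit).ne_zero ?_ ?_ ?_
  · intro D hD u hu
    have hD' : ∀ i, D i ≠ 0 := by simpa [Matrix.det_diagonal, Finset.prod_ne_zero_iff] using hD
    obtain ⟨u', hu', e, he, heH⟩ := hdiag ((fun i => Units.mk0 (D i) (hD' i)) * u)
    refine ⟨u', hu', _, heH, ?_⟩
    rw [← Units.val_mul, ← diagonalGL_mul, ← he, diagonalGL_mul]
    rfl
  · rintro ⟨i, j, hij, c⟩ u hu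
    exact ⟨u, hu, _, htrans i j hij _,
      congrArg Units.val (transvectionGL_mul_diagonalGL hij c u)⟩
  · intro M N _ _ hM hN u hu
    obtain ⟨u', hu', h, hh, e⟩ := hN u hu
    obtain ⟨u'', hu'', h', hh', e'⟩ := hM u' hu'
    refine ⟨u'', hu'', h' * h, H.mul_mem hh' hh, ?_⟩
    rw [mul_assoc, e, ← mul_assoc, e', mul_assoc, Units.val_mul]

end LinearGroup

section Adelic

variable {R : Type*} [CommRing R] [IsDomain R] [IsPrincipalIdealRing R]
  {K : Type*} [Field K] [Algebra R K] [IsFractionRing R K] {n : ℕ}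

variable (R K n) in
/-- The subgroup `GL_n(R_p)` of `GL_n(K_p)`. -/
noncomputable def integralGL (v : HeightOneSpectrum R) : Subgroup (GL (Fin n) (v.adicCompletion K)) where
  carrier := {A | IsIntegralGL R K n v A}
  one_mem' i j := by
    have : (1 : Matrix (Fin n) (Fin n) (v.adicCompletion K)) i j ∈ v.adicCompletionIntegers K := by
      rw [Matrix.one_apply]
      split_ifs
      exacts [one_mem _, zero_mem _]
    simpa using this
  mul_mem' {A B} hA hB i j := by
    rw [mul_inv_rev, Units.val_mul, Units.val_mul, Matrix.mul_apply, Matrix.mul_apply]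
    exact ⟨sum_mem fun k _ => mul_mem (hA i k).1 (hB k j).1,
      sum_mem fun k _ => mul_mem (hB i k).2 (hA k j).2⟩
  inv_mem' {A} hA i j := by
    rw [inv_inv]
    exact ⟨(hA i j).2, (hA i j).1⟩

theorem isOpen_integralGL (v : HeightOneSpectrum R) :
    IsOpen (integralGL R K n v : Set (GL (Fin n) (v.adicCompletion K))) := by
  have hO : IsOpen (v.adicCompletionIntegers K : Set (v.adicCompletion K)) :=
    Valued.isOpen_valuationSubring _
  have : (integralGL R K n v : Set (GL (Fin n) (v.adicCompletion K))) =
      ⋂ i, ⋂ j, {A | A.val i j ∈ v.adicCompletionIntegers K} ∩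
        {A | A⁻¹.val i j ∈ v.adicCompletionIntegers K} := by
    ext A
    simp only [Set.mem_iInter]
    rfl
  rw [this]
  refine isOpen_iInter_of_finite fun i => isOpen_iInter_of_finite fun j => ?_
  exact (hO.preimage (Units.continuous_val.matrix_elem i j)).inter
    (hO.preimage ((Units.continuous_val.comp continuous_inv).matrix_elem i j))

theorem transvectionGL_mem_integralGL {v : HeightOneSpectrum R} {i j : Fin n} (hij : i ≠ j)
    {c : v.adicCompletion K} (hc : c ∈ v.adicCompletionIntegers K) :
    transvectionGL hij c ∈ integralGL R K n v := by
  have key : ∀ x ∈ v.adicCompletionIntegers K, ∀ a b,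
      Matrix.transvection i j x a b ∈ v.adicCompletionIntegers K := by
    intro x hx a b
    simp only [Matrix.transvection, Matrix.add_apply, Matrix.one_apply, Matrix.single_apply]
    refine add_mem ?_ ?_ <;> split_ifs
    exacts [one_mem _, zero_mem _, hx, zero_mem _]
  exact fun a b => ⟨key c hc a b, key (-c) (neg_mem hc) a b⟩

theorem diagonalGL_mem_integralGL {v : HeightOneSpectrum R} {d : Fin n → (v.adicCompletion K)ˣ}
    (hd : ∀ i, Valued.v (d i : v.adicCompletion K) = 1) :
    diagonalGL d ∈ integralGL R K n v := by
  have key : ∀ x : Fin n → v.adicCompletion K, (∀ i, x i ∈ v.adicCompletionIntegers K) →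
      ∀ a b, Matrix.diagonal x a b ∈ v.adicCompletionIntegers K := by
    intro x hx a b
    rw [Matrix.diagonal_apply]
    split_ifs
    exacts [hx a, zero_mem _]
  refine fun a b => ⟨key _ (fun i => (hd i).le) a b, key _ (fun i => ?_) a b⟩
  rw [HeightOneSpectrum.mem_adicCompletionIntegers, Units.val_inv_eq_inv_val, map_inv₀, hd, inv_one]

variable (R K n) in
/-- The matrices in `GL_n(K)` that are integral, together with their inverse, at all primes other
than `v`. -/
noncomputable def integralAwayGL (v : HeightOneSpectrum R) : Subgroup (GL (Fin n) K) :=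
  ⨅ w : {w : HeightOneSpectrum R // w ≠ v}, (integralGL R K n w).comap (glEmb R K n w)

theorem mem_integralAwayGL {v : HeightOneSpectrum R} {B : GL (Fin n) K} :
    B ∈ integralAwayGL R K n v ↔ ∀ w ≠ v, glEmb R K n w B ∈ integralGL R K n w := by
  simp [integralAwayGL, Subgroup.mem_iInf]

theorem valued_algebraMap (v : HeightOneSpectrum R) (x : K) :
    Valued.v (algebraMap K (v.adicCompletion K) x) = v.valuation K x := by
  rw [HeightOneSpectrum.algebraMap_adicCompletion]
  exact HeightOneSpectrum.valuedAdicCompletion_eq_valuation' v x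

variable (K) in
/-- In a principal ideal domain, each nonzero prime has a uniformizer which is a unit at all other
primes. -/
theorem exists_uniformizer_away (v : HeightOneSpectrum R) :
    ∃ π : Kˣ, v.valuation K π = WithZero.exp (-1 : ℤ) ∧ ∀ w ≠ v, w.valuation K (π : K) = 1 := by
  obtain ⟨p, hp⟩ := (IsPrincipalIdealRing.principal v.asIdeal).principal
  have hp : v.asIdeal = Ideal.span {p} := hp
  have hp0 : p ≠ 0 := by
    rintro rfl
    exact v.ne_bot (by simpa using hp)
  refine ⟨Units.mk0 (algebraMap R K p) (by simpa using hp0), ?_, fun w hw => ?_⟩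
  · rw [Units.val_mk0, HeightOneSpectrum.valuation_of_algebraMap,
      v.intValuation_singleton hp0 hp]
  · rw [Units.val_mk0, HeightOneSpectrum.valuation_eq_one_iff_notMem]
    intro hpw
    have hle : v.asIdeal ≤ w.asIdeal := by rwa [hp, Ideal.span_singleton_le_iff_mem]
    exact hw (HeightOneSpectrum.ext (v.isMaximal.eq_of_le w.isPrime.ne_top hle).symm)

/-- Strong approximation at one prime: elements of `K` integral away from `v` are dense in the
completion at `v`. -/
theorem dense_integral_away (v : HeightOneSpectrum R) :
    Dense (algebraMap K (v.adicCompletion K) '' {y | ∀ w ≠ v, w.valuation K y ≤ 1}) := by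
  refine dense_closure.1 (Dense.mono ?_ (HeightOneSpectrum.denseRange_algebraMap K v))
  rintro _ ⟨x, rfl⟩
  rw [mem_closure_iff_nhds]
  intro t ht
  obtain ⟨γ, hγ⟩ := Valued.mem_nhds.1 ht
  obtain ⟨π, hπ, hπw⟩ := exists_uniformizer_away K v
  set m := WithZero.log (v.valuation K x)
  have hint : v.valuation K (x * (π : K) ^ m) ≤ 1 := by
    rcases eq_or_ne x 0 with rfl | hx
    · simp
    · have : v.valuation K x = WithZero.exp m := (WithZero.exp_log (by simpa using hx)).symm
      rw [map_mul, map_zpow₀, hπ, this, ← WithZero.exp_zsmul, ← WithZero.exp_add]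
      simp
  have hπm : v.valuation K ((π : K) ^ m) ≠ 0 :=
    (Valuation.ne_zero_iff _).2 (zpow_ne_zero _ π.ne_zero)
  obtain ⟨a, ha⟩ := HeightOneSpectrum.exists_valuation_sub_lt_of_integer v hint
    (Units.mk0 _ ((map_ne_zero MonoidWithZeroHom.ValueGroup₀.embedding).2 γ.ne_zero) *
      Units.mk0 _ hπm)
  refine ⟨algebraMap K _ (algebraMap R K a * (π : K) ^ (-m)), hγ ?_, _, fun w hw => ?_, rfl⟩
  · change Valued.v.restrict (_ - _) < γ.1
    rw [Valuation.restrict_lt_iff_lt_embedding, ← map_sub, valued_algebraMap]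
    rw [Units.val_mul, Units.val_mk0, Units.val_mk0] at ha
    refine lt_of_mul_lt_mul_right' (a := v.valuation K ((π : K) ^ m)) ?_
    rw [← map_mul, sub_mul, mul_assoc, ← zpow_add₀ π.ne_zero, neg_add_cancel, zpow_zero, mul_one]
    exact ha
  · rw [map_mul, map_zpow₀, hπw w hw, one_zpow, mul_one]
    exact w.valuation_le_one a

/-- The decomposition at a single prime. -/
theorem exists_integralGL_mul_glEmb (v : HeightOneSpectrum R)
    (A : GL (Fin n) (v.adicCompletion K)) :
    ∃ B ∈ integralAwayGL R K n v, A * (glEmb R K n v B)⁻¹ ∈ integralGL R K n v := by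
  set H := ((integralAwayGL R K n v).map (glEmb R K n v)).topologicalClosure
  obtain ⟨u, hu, h, hh, rfl⟩ := exists_eq_diagonalGL_mul
    (Units.map (Valued.v : Valuation (v.adicCompletion K) _).toMonoidWithZeroHom.toMonoidHom).ker H
    (fun i j hij c => by
      refine map_mem_closure (continuous_transvectionGL hij) (dense_integral_away v c) ?_
      rintro _ ⟨y, hy, rfl⟩
      refine ⟨transvectionGL hij y, mem_integralAwayGL.2 fun w hw => ?_,
        map_transvectionGL _ hij y⟩
      rw [glEmb, map_transvectionGL]
      refine transvectionGL_mem_integralGL hij ?_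
      rw [HeightOneSpectrum.mem_adicCompletionIntegers, valued_algebraMap]
      exact hy w hw)
    (fun d => by
      obtain ⟨π, hπ, hπw⟩ := exists_uniformizer_away K v
      let m : Fin n → ℤ := fun i => -WithZero.log (Valued.v (d i : v.adicCompletion K))
      let e : Fin n → Kˣ := fun i => π ^ m i
      let e' : Fin n → (v.adicCompletion K)ˣ :=
        fun i => Units.map (algebraMap K (v.adicCompletion K) : K →* _) (e i)
      refine ⟨d / e', fun i => ?_, e', by simp, ?_⟩
      · rw [MonoidHom.mem_ker]
        ext1
        have h1 : Valued.v (d i : v.adicCompletion K) = WithZero.exp (-m i) := by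
          simp only [m, neg_neg]
          exact (WithZero.exp_log (by simp)).symm
        have h2 : Valued.v (e' i : v.adicCompletion K) = WithZero.exp (-m i) := by
          change Valued.v (algebraMap K (v.adicCompletion K) (e i)) = _
          rw [valued_algebraMap]
          simp [e, hπ, ← WithZero.exp_zsmul]
        change Valued.v ((d i / e' i : (v.adicCompletion K)ˣ) : v.adicCompletion K) = 1
        rw [Units.val_div_eq_div_val, map_div₀, h1, h2, div_self WithZero.exp_ne_zero]
      · refine subset_closure ⟨diagonalGL e, mem_integralAwayGL.2 fun w hw => ?_,
          map_diagonalGL _ e⟩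
        rw [glEmb, map_diagonalGL]
        refine diagonalGL_mem_integralGL fun i => ?_
        change Valued.v (algebraMap K (w.adicCompletion K) (e i)) = 1
        rw [valued_algebraMap]
        simp [e, hπw w hw])
    A
  have hopen : IsOpen {g | h * g⁻¹ ∈ integralGL R K n v} :=
    (isOpen_integralGL v).preimage (continuous_const.mul continuous_inv)
  obtain ⟨_, hg, B, hB, rfl⟩ := mem_closure_iff.1 hh _ hopen (by simp [one_mem])
  refine ⟨B, hB, ?_⟩
  rw [mul_assoc]
  exact mul_mem (diagonalGL_mem_integralGL fun i => congrArg Units.val (hu i)) hg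

end Adelic

theorem stmt13 (R : Type*) [CommRing R] [IsDomain R] [IsPrincipalIdealRing R]
    (K : Type*) [Field K] [Algebra R K] [IsFractionRing R K] (n : ℕ)
    (A : ∀ v : HeightOneSpectrum R, GL (Fin n) (v.adicCompletion K))
    (hA : {v : HeightOneSpectrum R | ¬ IsIntegralGL R K n v (A v)}.Finite) :
    ∃ (C : ∀ v : HeightOneSpectrum R, GL (Fin n) (v.adicCompletion K)) (B : GL (Fin n) K),
      (∀ v, IsIntegralGL R K n v (C v)) ∧ ∀ v, A v = C v * glEmb R K n v B := by
  suffices key : ∀ s : Set (HeightOneSpectrum R), s.Finite →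
      ∀ A : ∀ v : HeightOneSpectrum R, GL (Fin n) (v.adicCompletion K),
        (∀ v ∉ s, A v ∈ integralGL R K n v) →
        ∃ B : GL (Fin n) K, ∀ v, A v * (glEmb R K n v B)⁻¹ ∈ integralGL R K n v by
    obtain ⟨B, hB⟩ := key _ hA A fun v hv => not_not.1 hv
    exact ⟨fun v => A v * (glEmb R K n v B)⁻¹, B, hB, fun v => by simp⟩
  intro s hs
  induction s, hs using Set.Finite.induction_on with
  | empty => exact fun A hA => ⟨1, fun v => by simpa using hA v⟩
  | @insert v s _ _ ih =>
    intro A hA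
    obtain ⟨B, hB, hAB⟩ := exists_integralGL_mul_glEmb v (A v)
    obtain ⟨B', hB'⟩ := ih (fun w => A w * (glEmb R K n w B)⁻¹) fun w hw => by
      rcases eq_or_ne w v with rfl | hwv
      · exact hAB
      · exact mul_mem (hA w (by simp [hw, hwv])) (inv_mem (mem_integralAwayGL.1 hB w hwv))
    exact ⟨B' * B, fun w => by simpa [mul_assoc] using hB' w⟩
end
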